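/- arXiv:1712.00398 — 2 statements merged into one kernel-verified Lean document; each statement's English description precedes it below -/
import Mathlib

section
/- Let Υ = (0,a) × (0,b) × (0,c) ⊂ ℝ³ with a, b, c > 0, let Γ₁ = { x ∈ ∂Υ : x₃ = 0 } be the top face and Γ₂ = ∂Υ \ closure(Γ₁) the rest of the boundary. Let q : closure(Υ) → ℝ be continuous and real-valued, let k₀ > 0, and let u : ℝ³ → ℂ be twice continuously differentiable on an open neighborhood of closure(Υ) with Δu + q u = 0 on Υ, u = 0 on Γ₁, and ∂_ν u(p) = i k₀ u(p) at every point p in the relative interior of each face of Υ contained in Γ₂, where ν is the outward unit normal to that face. Then u vanishes identically on Γ₂ (and consequently ∂_ν u = 0 on Γ₂ as well). -/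
open MeasureTheory Set

/-- Partial derivative in the first variable of a function `ℝ³ → ℂ` (curried form). -/
noncomputable def pd1 (f : ℝ → ℝ → ℝ → ℂ) (x y z : ℝ) : ℂ :=
  deriv (fun t => f t y z) x

/-- Partial derivative in the second variable. -/
noncomputable def pd2 (f : ℝ → ℝ → ℝ → ℂ) (x y z : ℝ) : ℂ :=
  deriv (fun t => f x t z) y

/-- Partial derivative in the third variable. -/
noncomputable def pd3 (f : ℝ → ℝ → ℝ → ℂ) (x y z : ℝ) : ℂ :=
  deriv (fun t => f x y t) z

/-- Laplacian `Δf = ∂₁²f + ∂₂²f + ∂₃²f` of a function `ℝ³ → ℂ` (curried form). -/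
noncomputable def lap (f : ℝ → ℝ → ℝ → ℂ) (x y z : ℝ) : ℂ :=
  pd1 (pd1 f) x y z + pd2 (pd2 f) x y z + pd3 (pd3 f) x y z

/-- The partial derivative of `G` in the `i`-th coordinate direction. -/
noncomputable def coordDeriv {ι : Type*} [Fintype ι] [DecidableEq ι] (G : (ι → ℝ) → ℂ) (i : ι)
    (p : ι → ℝ) : ℂ :=
  fderiv ℝ G p (Pi.single i 1)

/-- The `i`-th component of the energy flux of `G`. -/
noncomputable def energyFlux {ι : Type*} [Fintype ι] [DecidableEq ι] (G : (ι → ℝ) → ℂ) (i : ι)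
    (p : ι → ℝ) : ℝ :=
  (star (G p) * coordDeriv G i p).im

section Box

variable {ι : Type*}

theorem closure_pi_Ioo {l r : ι → ℝ} (h : ∀ i, l i < r i) :
    closure (univ.pi fun i => Ioo (l i) (r i)) = Icc l r := by
  simp only [closure_pi_set, fun i => closure_Ioo (h i).ne, pi_univ_Icc]

theorem pi_Ioo_subset_Icc (l r : ι → ℝ) : (univ.pi fun i => Ioo (l i) (r i)) ⊆ Icc l r := by
  rw [← pi_univ_Icc]
  exact pi_mono fun i _ => Ioo_subset_Icc_self

theorem eqOn_Icc_of_eqOn_pi_Ioo {l r : ι → ℝ} (h : ∀ i, l i < r i) {f g : (ι → ℝ) → ℝ}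
    (hf : ContinuousOn f (Icc l r)) (hg : ContinuousOn g (Icc l r))
    (hfg : EqOn f g (univ.pi fun i => Ioo (l i) (r i))) : EqOn f g (Icc l r) :=
  hfg.of_subset_closure hf hg (pi_Ioo_subset_Icc l r) (closure_pi_Ioo h).ge

theorem eqOn_zero_of_setIntegral_Icc_eq_zero [Fintype ι] {l r : ι → ℝ} (h : ∀ i, l i < r i)
    {f : (ι → ℝ) → ℝ} (hf : ContinuousOn f (Icc l r)) (h0 : ∀ x ∈ Icc l r, 0 ≤ f x)
    (hint : ∫ x in Icc l r, f x = 0) : EqOn f 0 (Icc l r) := by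
  have hae : f =ᵐ[volume.restrict (Icc l r)] 0 :=
    (setIntegral_eq_zero_iff_of_nonneg_ae
      (ae_restrict_of_forall_mem measurableSet_Icc h0) hf.integrableOn_Icc).1 hint
  refine Measure.eqOn_of_ae_eq hae hf continuousOn_const ?_
  rw [← pi_univ_Icc, interior_pi_set finite_univ]
  simp only [interior_Icc]
  rw [closure_pi_Ioo h, pi_univ_Icc]

variable [Fintype ι] [DecidableEq ι] {G : (ι → ℝ) → ℂ} {V : Set (ι → ℝ)}

theorem contDiffOn_coordDeriv (hV : IsOpen V) (hG : ContDiffOn ℝ 2 G V) (i : ι) :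
    ContDiffOn ℝ 1 (coordDeriv G i) V :=
  (hG.fderiv_of_isOpen hV (by norm_num)).clm_apply contDiffOn_const

theorem contDiffOn_energyFlux (hV : IsOpen V) (hG : ContDiffOn ℝ 2 G V) (i : ι) :
    ContDiffOn ℝ 1 (energyFlux G i) V := by
  have hstar : ContDiffOn ℝ 1 (fun p => star (G p)) V :=
    (starL' ℝ (A := ℂ)).contDiff.comp_contDiffOn (hG.of_le (by norm_num))
  exact Complex.imCLM.contDiff.comp_contDiffOn (hstar.mul (contDiffOn_coordDeriv hV hG i))

theorem fderiv_energyFlux (hV : IsOpen V) (hG : ContDiffOn ℝ 2 G V) {p : ι → ℝ} (hp : p ∈ V)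
    (i : ι) :
    fderiv ℝ (energyFlux G i) p (Pi.single i 1) =
      (star (G p) * coordDeriv (coordDeriv G i) i p).im := by
  have hGd : HasFDerivAt G (fderiv ℝ G p) p :=
    ((hG.differentiableOn (by norm_num)).differentiableAt (hV.mem_nhds hp)).hasFDerivAt
  have hDd : HasFDerivAt (coordDeriv G i) (fderiv ℝ (coordDeriv G i) p) p :=
    (((contDiffOn_coordDeriv hV hG i).differentiableOn (by norm_num)).differentiableAt
      (hV.mem_nhds hp)).hasFDerivAt
  have key : HasFDerivAt (energyFlux G i) _ p :=
    Complex.imCLM.hasFDerivAt.comp p (hGd.star.mul hDd)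
  rw [key.fderiv]
  have h1 : fderiv ℝ G p (Pi.single i 1) = coordDeriv G i p := rfl
  have h2 : fderiv ℝ (coordDeriv G i) p (Pi.single i 1) = coordDeriv (coordDeriv G i) i p := rfl
  simp [h1, h2]
  ring

end Box

/-- The imaginary part of Green's identity on a box. -/
theorem sum_energyFlux_faces_eq_zero {n : ℕ} {G : (Fin (n + 1) → ℝ) → ℂ}
    {V : Set (Fin (n + 1) → ℝ)} (hV : IsOpen V) (hG : ContDiffOn ℝ 2 G V)
    {l r : Fin (n + 1) → ℝ} (hlr : ∀ i, l i < r i) (hbox : Icc l r ⊆ V)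
    (hlap : ∀ p ∈ univ.pi fun i => Ioo (l i) (r i),
      (star (G p) * ∑ i, coordDeriv (coordDeriv G i) i p).im = 0) :
    ∑ i, ((∫ x in Icc (l ∘ i.succAbove) (r ∘ i.succAbove), energyFlux G i (i.insertNth (r i) x)) -
      ∫ x in Icc (l ∘ i.succAbove) (r ∘ i.succAbove), energyFlux G i (i.insertNth (l i) x)) = 0 := by
  have hF := contDiffOn_energyFlux hV hG
  have hdiv : ContinuousOn
      (fun p => ∑ i, fderiv ℝ (energyFlux G i) p (Pi.single i 1)) (Icc l r) :=
    continuousOn_finsetSum _ fun i _ =>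
      (((hF i).continuousOn_fderiv_of_isOpen hV le_rfl).clm_apply continuousOn_const).mono hbox
  rw [← integral_divergence_of_hasFDerivAt_off_countable' l r (fun i => (hlr i).le)
    (energyFlux G) (fun i => fderiv ℝ (energyFlux G i)) ∅ countable_empty
    (fun i => (hF i).continuousOn.mono hbox)
    (fun x hx i => (((hF i).differentiableOn (by norm_num)).differentiableAt
      (hV.mem_nhds (hbox (pi_Ioo_subset_Icc l r hx.1)))).hasFDerivAt)
    hdiv.integrableOn_Icc]
  refine setIntegral_eq_zero_of_forall_eq_zero
    (eqOn_Icc_of_eqOn_pi_Ioo hlr hdiv continuousOn_const fun p hp => ?_)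
  have hpV := hbox (pi_Ioo_subset_Icc l r hp)
  have := hlap p hp
  simp only [fun i => fderiv_energyFlux hV hG hpV i]
  rw [← this, Finset.mul_sum, Complex.im_sum]

theorem insertNth_mem_Icc_of_mem {n : ℕ} {l r : Fin (n + 1) → ℝ} {i : Fin (n + 1)} {t : ℝ}
    (ht : t ∈ Icc (l i) (r i)) {x : Fin n → ℝ}
    (hx : x ∈ Icc (l ∘ i.succAbove) (r ∘ i.succAbove)) : i.insertNth t x ∈ Icc l r := by
  rw [Fin.insertNth_mem_Icc]
  exact ⟨ht, hx⟩

/-- If at each boundary point of a box either the impedance condition holds or `G` vanishes, and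
`Im (conj G * ΔG) = 0` inside, then `G` vanishes on all faces. -/
theorem eq_zero_on_faces_of_impedance {n : ℕ} {G : (Fin (n + 1) → ℝ) → ℂ}
    {V : Set (Fin (n + 1) → ℝ)} (hV : IsOpen V) (hG : ContDiffOn ℝ 2 G V)
    {l r : Fin (n + 1) → ℝ} (hlr : ∀ i, l i < r i) (hbox : Icc l r ⊆ V)
    (hlap : ∀ p ∈ univ.pi fun i => Ioo (l i) (r i),
      (star (G p) * ∑ i, coordDeriv (coordDeriv G i) i p).im = 0)
    {k : ℝ} (hk : 0 < k)
    (hr : ∀ i, ∀ x ∈ univ.pi fun j => Ioo (l (i.succAbove j)) (r (i.succAbove j)),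
      coordDeriv G i (i.insertNth (r i) x) = Complex.I * k * G (i.insertNth (r i) x) ∨
        G (i.insertNth (r i) x) = 0)
    (hl : ∀ i, ∀ x ∈ univ.pi fun j => Ioo (l (i.succAbove j)) (r (i.succAbove j)),
      -coordDeriv G i (i.insertNth (l i) x) = Complex.I * k * G (i.insertNth (l i) x) ∨
        G (i.insertNth (l i) x) = 0)
    (i : Fin (n + 1)) {x : Fin n → ℝ} (hx : x ∈ Icc (l ∘ i.succAbove) (r ∘ i.succAbove)) :
    G (i.insertNth (r i) x) = 0 ∧ G (i.insertNth (l i) x) = 0 := by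
  have hface : ∀ i : Fin (n + 1), ∀ j, (l ∘ i.succAbove) j < (r ∘ i.succAbove) j :=
    fun i j => hlr _
  have hins : ∀ (i : Fin (n + 1)) (t : ℝ), Continuous fun x : Fin n → ℝ =>
      (i.insertNth t x : Fin (n + 1) → ℝ) :=
    fun i t => continuous_const.finInsertNth i continuous_id
  have hmaps : ∀ (i : Fin (n + 1)) (t : ℝ), t ∈ Icc (l i) (r i) →
      MapsTo (fun x : Fin n → ℝ => (i.insertNth t x : Fin (n + 1) → ℝ))
        (Icc (l ∘ i.succAbove) (r ∘ i.succAbove)) V :=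
    fun i t ht x hx => hbox (insertNth_mem_Icc_of_mem ht hx)
  have hcF : ∀ (i : Fin (n + 1)) (t : ℝ), t ∈ Icc (l i) (r i) →
      ContinuousOn (fun x : Fin n → ℝ => energyFlux G i (i.insertNth t x))
        (Icc (l ∘ i.succAbove) (r ∘ i.succAbove)) := fun i t ht =>
    (contDiffOn_energyFlux hV hG i).continuousOn.comp (hins i t).continuousOn (hmaps i t ht)
  have hcN : ∀ (i : Fin (n + 1)) (t : ℝ), t ∈ Icc (l i) (r i) →
      ContinuousOn (fun x : Fin n → ℝ => k * Complex.normSq (G (i.insertNth t x)))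
        (Icc (l ∘ i.succAbove) (r ∘ i.succAbove)) := fun i t ht =>
    continuousOn_const.mul (Complex.continuous_normSq.comp_continuousOn
      (hG.continuousOn.comp (hins i t).continuousOn (hmaps i t ht)))
  have hright : ∀ i, r i ∈ Icc (l i) (r i) := fun i => right_mem_Icc.2 (hlr i).le
  have hleft : ∀ i, l i ∈ Icc (l i) (r i) := fun i => left_mem_Icc.2 (hlr i).le
  have him : ∀ w : ℂ, (star w * (Complex.I * k * w)).im = k * Complex.normSq w := fun w => by
    simp [Complex.normSq_apply]
    ring
  have hFr : ∀ i, EqOn (fun x : Fin n → ℝ => energyFlux G i (i.insertNth (r i) x))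
      (fun x => k * Complex.normSq (G (i.insertNth (r i) x)))
      (Icc (l ∘ i.succAbove) (r ∘ i.succAbove)) := fun i =>
    eqOn_Icc_of_eqOn_pi_Ioo (hface i) (hcF i _ (hright i)) (hcN i _ (hright i)) fun x hx => by
      rcases hr i x hx with h | h
      · simp only [energyFlux, h, him]
      · simp [energyFlux, h]
  have hFl : ∀ i, EqOn (fun x : Fin n → ℝ => energyFlux G i (i.insertNth (l i) x))
      (fun x => -(k * Complex.normSq (G (i.insertNth (l i) x))))
      (Icc (l ∘ i.succAbove) (r ∘ i.succAbove)) := fun i =>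
    eqOn_Icc_of_eqOn_pi_Ioo (hface i) (hcF i _ (hleft i)) (hcN i _ (hleft i)).neg fun x hx => by
      rcases hl i x hx with h | h
      · simp only [energyFlux, neg_eq_iff_eq_neg.1 h, mul_neg, Complex.neg_im, him]
      · simp [energyFlux, h]
  have hsum := sum_energyFlux_faces_eq_zero hV hG hlr hbox hlap
  rw [Finset.sum_congr rfl fun i _ => congrArg₂ (· - ·)
    (setIntegral_congr_fun measurableSet_Icc (hFr i))
    (setIntegral_congr_fun measurableSet_Icc (hFl i))] at hsum
  simp only [integral_neg, sub_neg_eq_add] at hsum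
  have hnn : ∀ (i : Fin (n + 1)) (t : ℝ) (x : Fin n → ℝ),
      0 ≤ k * Complex.normSq (G (i.insertNth t x)) :=
    fun i t x => mul_nonneg hk.le (Complex.normSq_nonneg _)
  have hnnI : ∀ (i : Fin (n + 1)) (t : ℝ), 0 ≤ ∫ x in Icc (l ∘ i.succAbove) (r ∘ i.succAbove),
      k * Complex.normSq (G (i.insertNth t x)) := fun i t => integral_nonneg (hnn i t)
  have hi := (Finset.sum_eq_zero_iff_of_nonneg
    fun i _ => add_nonneg (hnnI i (r i)) (hnnI i (l i))).1 hsum i (Finset.mem_univ i)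
  obtain ⟨hir, hil⟩ := (add_eq_zero_iff_of_nonneg (hnnI i (r i)) (hnnI i (l i))).1 hi
  have hzero : ∀ t ∈ Icc (l i) (r i), (∫ x in Icc (l ∘ i.succAbove) (r ∘ i.succAbove),
      k * Complex.normSq (G (i.insertNth t x))) = 0 → G (i.insertNth t x) = 0 := by
    intro t ht hint
    have := eqOn_zero_of_setIntegral_Icc_eq_zero (hface i) (hcN i t ht) (fun x _ => hnn i t x)
      hint hx
    simpa [hk.ne'] using this
  exact ⟨hzero _ (hright i) hir, hzero _ (hleft i) hil⟩

section Curried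

/-- A function of three real variables as a function on `Fin 3 → ℝ`. -/
def uncurryFin3 (f : ℝ → ℝ → ℝ → ℂ) (p : Fin 3 → ℝ) : ℂ :=
  f (p 0) (p 1) (p 2)

variable {f : ℝ → ℝ → ℝ → ℂ} {p : Fin 3 → ℝ}

theorem deriv_comp_update_eq_coordDeriv {ι : Type*} [Fintype ι] [DecidableEq ι] {G : (ι → ℝ) → ℂ}
    {p : ι → ℝ} (h : DifferentiableAt ℝ G p) (i : ι) :
    deriv (fun t => G (Function.update p i t)) (p i) = coordDeriv G i p := by
  have hG : HasFDerivAt G (fderiv ℝ G p) (Function.update p i (p i)) := by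
    simpa using h.hasFDerivAt
  exact (hG.comp_hasDerivAt (p i) (hasDerivAt_update p i (p i))).deriv

theorem pd1_eq_coordDeriv (h : DifferentiableAt ℝ (uncurryFin3 f) p) :
    pd1 f (p 0) (p 1) (p 2) = coordDeriv (uncurryFin3 f) 0 p := by
  rw [← deriv_comp_update_eq_coordDeriv h]
  simp [uncurryFin3, pd1, Function.update]

theorem pd2_eq_coordDeriv (h : DifferentiableAt ℝ (uncurryFin3 f) p) :
    pd2 f (p 0) (p 1) (p 2) = coordDeriv (uncurryFin3 f) 1 p := by
  rw [← deriv_comp_update_eq_coordDeriv h]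
  simp [uncurryFin3, pd2, Function.update]

theorem pd3_eq_coordDeriv (h : DifferentiableAt ℝ (uncurryFin3 f) p) :
    pd3 f (p 0) (p 1) (p 2) = coordDeriv (uncurryFin3 f) 2 p := by
  rw [← deriv_comp_update_eq_coordDeriv h]
  simp [uncurryFin3, pd3, Function.update]

theorem lap_eq_sum_coordDeriv {V : Set (Fin 3 → ℝ)} (hV : IsOpen V)
    (hf : ContDiffOn ℝ 2 (uncurryFin3 f) V) (hp : p ∈ V) :
    lap f (p 0) (p 1) (p 2) = ∑ i, coordDeriv (coordDeriv (uncurryFin3 f) i) i p := by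
  have hd : ∀ q ∈ V, DifferentiableAt ℝ (uncurryFin3 f) q := fun q hq =>
    (hf.differentiableOn (by norm_num)).differentiableAt (hV.mem_nhds hq)
  have hD : ∀ i, DifferentiableAt ℝ (coordDeriv (uncurryFin3 f) i) p := fun i =>
    ((contDiffOn_coordDeriv hV hf i).differentiableOn (by norm_num)).differentiableAt
      (hV.mem_nhds hp)
  have h1 : uncurryFin3 (pd1 f) =ᶠ[nhds p] coordDeriv (uncurryFin3 f) 0 := by
    filter_upwards [hV.mem_nhds hp] with q hq using pd1_eq_coordDeriv (hd q hq)
  have h2 : uncurryFin3 (pd2 f) =ᶠ[nhds p] coordDeriv (uncurryFin3 f) 1 := by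
    filter_upwards [hV.mem_nhds hp] with q hq using pd2_eq_coordDeriv (hd q hq)
  have h3 : uncurryFin3 (pd3 f) =ᶠ[nhds p] coordDeriv (uncurryFin3 f) 2 := by
    filter_upwards [hV.mem_nhds hp] with q hq using pd3_eq_coordDeriv (hd q hq)
  rw [lap, pd1_eq_coordDeriv ((hD 0).congr_of_eventuallyEq h1),
    pd2_eq_coordDeriv ((hD 1).congr_of_eventuallyEq h2),
    pd3_eq_coordDeriv ((hD 2).congr_of_eventuallyEq h3), Fin.sum_univ_three]
  simp only [coordDeriv, h1.fderiv_eq, h2.fderiv_eq, h3.fderiv_eq]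

end Curried

/-- On the box `Υ = (0,a) × (0,b) × (0,c)`, a solution of `Δu + q u = 0` (with `q` real
valued and continuous) which vanishes on the top face `Γ₁ = {x₃ = 0}` and satisfies the
impedance condition `∂_ν u = i k₀ u` on the relative interior of each remaining face,
vanishes identically on `Γ₂ = ∂Υ \ closure Γ₁` and has vanishing outward normal
derivative there. -/
theorem vanishing_on_impedance_boundary
    (a b c k₀ : ℝ) (ha : 0 < a) (hb : 0 < b) (hc : 0 < c) (hk₀ : 0 < k₀)
    (q : ℝ × ℝ × ℝ → ℝ)
    (hq : ContinuousOn q (Icc 0 a ×ˢ Icc 0 b ×ˢ Icc 0 c))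
    (u : ℝ → ℝ → ℝ → ℂ)
    (U : Set (ℝ × ℝ × ℝ)) (hU : IsOpen U)
    (hQU : Icc 0 a ×ˢ Icc 0 b ×ˢ Icc 0 c ⊆ U)
    (hu : ContDiffOn ℝ 2 (fun p : ℝ × ℝ × ℝ => u p.1 p.2.1 p.2.2) U)
    (hpde : ∀ p ∈ Ioo 0 a ×ˢ Ioo 0 b ×ˢ Ioo 0 c,
      lap u p.1 p.2.1 p.2.2 + (q p : ℂ) * u p.1 p.2.1 p.2.2 = 0)
    (hdir : ∀ x ∈ Icc 0 a, ∀ y ∈ Icc 0 b, u x y 0 = 0)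
    (himp1m : ∀ y ∈ Ioo 0 b, ∀ z ∈ Ioo 0 c,
      -pd1 u 0 y z = Complex.I * (k₀ : ℂ) * u 0 y z)
    (himp1p : ∀ y ∈ Ioo 0 b, ∀ z ∈ Ioo 0 c,
      pd1 u a y z = Complex.I * (k₀ : ℂ) * u a y z)
    (himp2m : ∀ x ∈ Ioo 0 a, ∀ z ∈ Ioo 0 c,
      -pd2 u x 0 z = Complex.I * (k₀ : ℂ) * u x 0 z)
    (himp2p : ∀ x ∈ Ioo 0 a, ∀ z ∈ Ioo 0 c,
      pd2 u x b z = Complex.I * (k₀ : ℂ) * u x b z)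
    (himp3p : ∀ x ∈ Ioo 0 a, ∀ y ∈ Ioo 0 b,
      pd3 u x y c = Complex.I * (k₀ : ℂ) * u x y c) :
    (∀ p ∈ frontier (Ioo 0 a ×ˢ Ioo 0 b ×ˢ Ioo 0 c) \
        (Icc 0 a ×ˢ Icc 0 b ×ˢ ({0} : Set ℝ)),
      u p.1 p.2.1 p.2.2 = 0) ∧
    (∀ y ∈ Ioo 0 b, ∀ z ∈ Ioo 0 c, pd1 u 0 y z = 0 ∧ pd1 u a y z = 0) ∧
    (∀ x ∈ Ioo 0 a, ∀ z ∈ Ioo 0 c, pd2 u x 0 z = 0 ∧ pd2 u x b z = 0) ∧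
    (∀ x ∈ Ioo 0 a, ∀ y ∈ Ioo 0 b, pd3 u x y c = 0) := by
  set G := uncurryFin3 u with hGdef
  have hφ : ContDiff ℝ 2 fun p : Fin 3 → ℝ => (p 0, p 1, p 2) := by fun_prop
  set V : Set (Fin 3 → ℝ) := (fun p => (p 0, p 1, p 2)) ⁻¹' U with hVdef
  have hV : IsOpen V := hU.preimage hφ.continuous
  have hG : ContDiffOn ℝ 2 G V := hu.comp hφ.contDiffOn fun p hp => hp
  have hlr : ∀ i, (0 : Fin 3 → ℝ) i < ![a, b, c] i := by
    simp [Fin.forall_fin_succ, ha, hb, hc]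
  have hbox : Icc (0 : Fin 3 → ℝ) ![a, b, c] ⊆ V := fun p hp =>
    hQU ⟨⟨hp.1 0, hp.2 0⟩, ⟨hp.1 1, hp.2 1⟩, ⟨hp.1 2, hp.2 2⟩⟩
  have hd : ∀ p ∈ Icc (0 : Fin 3 → ℝ) ![a, b, c], DifferentiableAt ℝ G p := fun p hp =>
    (hG.differentiableOn (by norm_num)).differentiableAt (hV.mem_nhds (hbox hp))
  have hlap : ∀ p ∈ univ.pi fun i => Ioo ((0 : Fin 3 → ℝ) i) (![a, b, c] i),
      (star (G p) * ∑ i, coordDeriv (coordDeriv G i) i p).im = 0 := fun p hp => by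
    rw [← lap_eq_sum_coordDeriv hV hG (hbox (pi_Ioo_subset_Icc _ _ hp)),
      eq_neg_of_add_eq_zero_left (hpde (p 0, p 1, p 2)
        ⟨hp 0 trivial, hp 1 trivial, hp 2 trivial⟩)]
    simp [hGdef, uncurryFin3]
    ring
  have hfaces := fun i x => eq_zero_on_faces_of_impedance hV hG hlr hbox hlap hk₀ ?_ ?_ i (x := x)
  rotate_left
  · intro i x hx
    have hp : i.insertNth (![a, b, c] i) x ∈ Icc (0 : Fin 3 → ℝ) ![a, b, c] :=
      insertNth_mem_Icc_of_mem (right_mem_Icc.2 (hlr i).le) (pi_Ioo_subset_Icc _ _ hx)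
    have hx0 := hx 0 trivial
    have hx1 := hx 1 trivial
    left
    fin_cases i
    · exact (pd1_eq_coordDeriv (hd _ hp)).symm.trans (himp1p _ hx0 _ hx1)
    · exact (pd2_eq_coordDeriv (hd _ hp)).symm.trans (himp2p _ hx0 _ hx1)
    · exact (pd3_eq_coordDeriv (hd _ hp)).symm.trans (himp3p _ hx0 _ hx1)
  · intro i x hx
    have hp : i.insertNth ((0 : Fin 3 → ℝ) i) x ∈ Icc (0 : Fin 3 → ℝ) ![a, b, c] :=
      insertNth_mem_Icc_of_mem (left_mem_Icc.2 (hlr i).le) (pi_Ioo_subset_Icc _ _ hx)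
    have hx0 := hx 0 trivial
    have hx1 := hx 1 trivial
    fin_cases i
    · exact .inl ((congrArg _ (pd1_eq_coordDeriv (hd _ hp)).symm).trans (himp1m _ hx0 _ hx1))
    · exact .inl ((congrArg _ (pd2_eq_coordDeriv (hd _ hp)).symm).trans (himp2m _ hx0 _ hx1))
    · exact .inr (hdir _ (Ioo_subset_Icc_self hx0) _ (Ioo_subset_Icc_self hx1))
  have h1 : ∀ y ∈ Icc 0 b, ∀ z ∈ Icc 0 c, u a y z = 0 ∧ u 0 y z = 0 := fun y hy z hz =>
    hfaces 0 ![y, z] (by simp [Pi.le_def, Fin.forall_fin_succ, hy.1, hy.2, hz.1, hz.2])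
  have h2 : ∀ x ∈ Icc 0 a, ∀ z ∈ Icc 0 c, u x b z = 0 ∧ u x 0 z = 0 := fun x hx z hz =>
    hfaces 1 ![x, z] (by simp [Pi.le_def, Fin.forall_fin_succ, Fin.succAbove, hx.1, hx.2,
      hz.1, hz.2])
  have h3 : ∀ x ∈ Icc 0 a, ∀ y ∈ Icc 0 b, u x y c = 0 ∧ u x y 0 = 0 := fun x hx y hy =>
    hfaces 2 ![x, y] (by simp [Pi.le_def, Fin.forall_fin_succ, Fin.succAbove, hx.1, hx.2,
      hy.1, hy.2])
  refine ⟨?_, fun y hy z hz => ?_, fun x hx z hz => ?_, fun x hx y hy => ?_⟩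
  · rintro ⟨x, y, z⟩ ⟨hp, -⟩
    rw [frontier, ((isOpen_Ioo.prod (isOpen_Ioo.prod isOpen_Ioo))).interior_eq, closure_prod_eq,
      closure_prod_eq, closure_Ioo ha.ne, closure_Ioo hb.ne, closure_Ioo hc.ne] at hp
    obtain ⟨⟨hx, hy, hz⟩, hn⟩ := hp
    simp only at hx hy hz
    rcases eq_endpoints_or_mem_Ioo_of_mem_Icc hx with rfl | rfl | hx'
    · exact (h1 y hy z hz).2
    · exact (h1 y hy z hz).1
    rcases eq_endpoints_or_mem_Ioo_of_mem_Icc hy with rfl | rfl | hy'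
    · exact (h2 x hx z hz).2
    · exact (h2 x hx z hz).1
    rcases eq_endpoints_or_mem_Ioo_of_mem_Icc hz with rfl | rfl | hz'
    · exact (h3 x hx y hy).2
    · exact (h3 x hx y hy).1
    exact absurd ⟨hx', hy', hz'⟩ hn
  · obtain ⟨hr, hl⟩ := h1 y (Ioo_subset_Icc_self hy) z (Ioo_subset_Icc_self hz)
    exact ⟨by simpa [hl] using himp1m y hy z hz, by simpa [hr] using himp1p y hy z hz⟩
  · obtain ⟨hr, hl⟩ := h2 x (Ioo_subset_Icc_self hx) z (Ioo_subset_Icc_self hz)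
    exact ⟨by simpa [hl] using himp2m x hx z hz, by simpa [hr] using himp2p x hx z hz⟩
  · simpa [(h3 x (Ioo_subset_Icc_self hx) y (Ioo_subset_Icc_self hy)).1] using himp3p x hx y hy
end

section
/- Let Υ = (0,a) × (0,b) × (0,c) ⊂ ℝ³ with a, b, c > 0, let Γ₁ = { x ∈ ∂Υ : x₃ = 0 } be the top face and Γ₂ = ∂Υ \ closure(Γ₁) the rest of the boundary. Let q : closure(Υ) → ℝ be continuous and real-valued, let k₀ > 0, and let u : ℝ³ → ℂ be twice continuously differentiable on an open neighborhood of closure(Υ) with Δu + q u = 0 on Υ, u = 0 on Γ₁, and ∂_ν u(p) = i k₀ u(p) at every point p in the relative interior of each face of Υ contained in Γ₂, where ν is the outward unit normal to that face. Then u ≡ 0 on Υ (uniqueness for the mixed Dirichlet–impedance boundary value problem). -/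
open MeasureTheory Set

/-- The `i`-th partial derivative of a real function on `ℝⁿ`. -/
noncomputable def partialD {n : ℕ} (i : Fin n) (f : (Fin n → ℝ) → ℝ) (x : Fin n → ℝ) : ℝ :=
  fderiv ℝ f x (Pi.single i 1)

/-- The closed face `x i = t` of the box `[0, A]`. -/
def closedFace {n : ℕ} (A : Fin n → ℝ) (i : Fin n) (t : ℝ) : Set (Fin n → ℝ) :=
  {x | x i = t ∧ ∀ j ≠ i, x j ∈ Icc 0 (A j)}

/-- The relative interior of the face `x i = t` of the box `[0, A]`. -/
def openFace {n : ℕ} (A : Fin n → ℝ) (i : Fin n) (t : ℝ) : Set (Fin n → ℝ) :=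
  {x | x i = t ∧ ∀ j ≠ i, x j ∈ Ioo 0 (A j)}

lemma closedFace_subset_Icc {n : ℕ} {A : Fin n → ℝ} {i : Fin n} {t : ℝ}
    (ht : t ∈ Icc 0 (A i)) : closedFace A i t ⊆ Icc 0 A := by
  rintro x ⟨hx, hx'⟩
  rw [← pi_univ_Icc]
  intro j _
  by_cases h : j = i
  · subst h; rw [hx]; exact ht
  · exact hx' j h

lemma openFace_subset_closedFace {n : ℕ} {A : Fin n → ℝ} {i : Fin n} {t : ℝ} :
    openFace A i t ⊆ closedFace A i t :=
  fun _ hx => ⟨hx.1, fun j hj => Ioo_subset_Icc_self (hx.2 j hj)⟩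

lemma closedFace_subset_closure_openFace {n : ℕ} {A : Fin n → ℝ} (hA : ∀ i, 0 < A i)
    (i : Fin n) (t : ℝ) : closedFace A i t ⊆ closure (openFace A i t) := by
  have h1 : openFace A i t = pi univ (fun j => if j = i then {t} else Ioo 0 (A j)) := by
    ext x
    simp only [openFace, mem_ofPred_eq, mem_pi, mem_univ, true_imp_iff]
    refine ⟨fun h j => ?_, fun h => ⟨by simpa using h i, fun j hj => by simpa [hj] using h j⟩⟩
    split_ifs with hj
    · subst hj; exact h.1
    · exact h.2 j hj
  rw [h1, closure_pi_set]
  rintro x ⟨hx, hx'⟩ j _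
  dsimp only
  split_ifs with hj
  · subst hj; simp [hx]
  · rw [closure_Ioo (hA j).ne]; exact hx' j hj

lemma eq_on_closedFace {n : ℕ} {A : Fin n → ℝ} (hA : ∀ i, 0 < A i) {i : Fin n} {t : ℝ}
    (ht : t ∈ Icc 0 (A i)) {g h : (Fin n → ℝ) → ℝ} (hg : ContinuousOn g (Icc 0 A))
    (hh : ContinuousOn h (Icc 0 A))
    (heq : EqOn g h (openFace A i t)) : EqOn g h (closedFace A i t) :=
  heq.of_subset_closure (hg.mono (closedFace_subset_Icc ht)) (hh.mono (closedFace_subset_Icc ht))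
    openFace_subset_closedFace (closedFace_subset_closure_openFace hA i t)

lemma Icc_subset_closure_interior_pi {n : ℕ} {A : Fin n → ℝ} (hA : ∀ i, 0 < A i) :
    Icc 0 A ⊆ closure (pi univ fun i => Ioo 0 (A i)) := by
  rw [closure_pi_set, ← pi_univ_Icc]
  intro x hx j _
  simp only [closure_Ioo (hA j).ne]
  exact hx j (mem_univ j)

lemma interior_Icc_pi {n : ℕ} (A : Fin n → ℝ) :
    interior (Icc 0 A) = pi univ fun i => Ioo 0 (A i) := by
  simp [← pi_univ_Icc, interior_pi_set finite_univ]

lemma eqOn_zero_of_integral_eq_zero {n : ℕ} {A : Fin n → ℝ} (hA : ∀ i, 0 < A i)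
    {g : (Fin n → ℝ) → ℝ} (hg : ContinuousOn g (Icc 0 A)) (hpos : ∀ x ∈ Icc 0 A, 0 ≤ g x)
    (h : ∫ x in Icc 0 A, g x = 0) : ∀ x ∈ Icc 0 A, g x = 0 := by
  have hae := (setIntegral_eq_zero_iff_of_nonneg_ae
    ((ae_restrict_iff' measurableSet_Icc).2 (Filter.Eventually.of_forall hpos))
    (hg.integrableOn_compact isCompact_Icc)).1 h
  refine Measure.eqOn_of_ae_eq hae hg continuousOn_const ?_
  rw [interior_Icc_pi]
  exact Icc_subset_closure_interior_pi hA

lemma insertNth_mem_closedFace {n : ℕ} {A : Fin (n + 1) → ℝ} {i : Fin (n + 1)} {t : ℝ}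
    {x : Fin n → ℝ} (hx : x ∈ Icc 0 (A ∘ i.succAbove)) :
    (i.insertNth t x : Fin (n + 1) → ℝ) ∈ closedFace A i t := by
  refine ⟨by simp, fun j hj => ?_⟩
  obtain ⟨k, rfl⟩ := Fin.exists_succAbove_eq hj
  simpa using ⟨hx.1 k, hx.2 k⟩

lemma partialD_continuousOn {n : ℕ} {V : Set (Fin n → ℝ)} (hV : IsOpen V)
    {f : (Fin n → ℝ) → ℝ} (hf : ContDiffOn ℝ 1 f V) (i : Fin n) :
    ContinuousOn (partialD i f) V :=
  (hf.continuousOn_fderiv_of_isOpen hV le_rfl).clm_apply continuousOn_const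

lemma partialD_contDiffOn {n : ℕ} {V : Set (Fin n → ℝ)} (hV : IsOpen V)
    {f : (Fin n → ℝ) → ℝ} (hf : ContDiffOn ℝ 2 f V) (i : Fin n) :
    ContDiffOn ℝ 1 (partialD i f) V :=
  (hf.fderiv_of_isOpen hV (by norm_num)).clm_apply contDiffOn_const

/-- If a vector field on a box has nonnegative divergence and nonpositive outward flux density,
then both vanish identically. -/
theorem divergence_rigidity {n : ℕ} {A : Fin (n + 1) → ℝ} (hA : ∀ i, 0 < A i)
    {V : Set (Fin (n + 1) → ℝ)} (hV : IsOpen V) (hAV : Icc 0 A ⊆ V)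
    {F : Fin (n + 1) → (Fin (n + 1) → ℝ) → ℝ} (hF : ∀ i, ContDiffOn ℝ 1 (F i) V)
    (hdiv : ∀ x ∈ Icc 0 A, 0 ≤ ∑ i, partialD i (F i) x)
    (hfront : ∀ i, ∀ x ∈ closedFace A i (A i), F i x ≤ 0)
    (hback : ∀ i, ∀ x ∈ closedFace A i 0, 0 ≤ F i x) :
    (∀ x ∈ Icc 0 A, ∑ i, partialD i (F i) x = 0) ∧
    (∀ i, ∀ x ∈ closedFace A i (A i), F i x = 0) ∧ ∀ i, ∀ x ∈ closedFace A i 0, F i x = 0 := by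
  have hA0 : (0 : Fin (n + 1) → ℝ) ≤ A := fun i => (hA i).le
  have hcont : ContinuousOn (fun x => ∑ i, partialD i (F i) x) (Icc 0 A) :=
    continuousOn_finsetSum _ fun i _ => (partialD_continuousOn hV (hF i) i).mono hAV
  have key : (∫ x in Icc 0 A, ∑ i, partialD i (F i) x) = _ :=
    integral_divergence_of_hasFDerivAt_off_countable' 0 A hA0 F (fun i => fderiv ℝ (F i)) ∅
    countable_empty (fun i => (hF i).continuousOn.mono hAV)
    (fun x hx i => by
      have hxV : x ∈ V := hAV (by
        rw [← pi_univ_Icc]; exact fun j _ => Ioo_subset_Icc_self (hx.1 j (mem_univ j)))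
      exact (((hF i).differentiableOn one_ne_zero).differentiableAt (hV.mem_nhds hxV)).hasFDerivAt)
    (hcont.integrableOn_compact isCompact_Icc)
  have hface : ∀ i, ∀ t ∈ Icc 0 (A i), ContinuousOn
      (fun x : Fin n → ℝ => F i (i.insertNth t x)) (Icc 0 (A ∘ i.succAbove)) := by
    intro i t ht
    refine ((hF i).continuousOn.mono hAV).comp (Continuous.continuousOn (by fun_prop)) ?_
    exact fun x hx => closedFace_subset_Icc ht (insertNth_mem_closedFace hx)
  have h0 : ∀ i, (0 : ℝ) ∈ Icc 0 (A i) := fun i => ⟨le_rfl, (hA i).le⟩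
  have h1 : ∀ i, A i ∈ Icc 0 (A i) := fun i => ⟨(hA i).le, le_rfl⟩
  have hIf : ∀ i, ∫ x in Icc 0 (A ∘ i.succAbove), F i (i.insertNth (A i) x) ≤ 0 := fun i =>
    setIntegral_nonpos measurableSet_Icc fun x hx => hfront i _ (insertNth_mem_closedFace hx)
  have hIb : ∀ i, 0 ≤ ∫ x in Icc 0 (A ∘ i.succAbove), F i (i.insertNth 0 x) := fun i =>
    setIntegral_nonneg measurableSet_Icc fun x hx => hback i _ (insertNth_mem_closedFace hx)
  have hI : 0 ≤ ∫ x in Icc 0 A, ∑ i, partialD i (F i) x :=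
    setIntegral_nonneg measurableSet_Icc hdiv
  set S : Fin (n + 1) → ℝ := fun i => (∫ x in Icc 0 (A ∘ i.succAbove), F i (i.insertNth (A i) x))
    - ∫ x in Icc 0 (A ∘ i.succAbove), F i (i.insertNth 0 x) with hS
  replace key : (∫ x in Icc 0 A, ∑ i, partialD i (F i) x) = ∑ i, S i := key
  have hSi : ∀ i, S i ≤ 0 := fun i => by simp only [hS]; linarith [hIf i, hIb i]
  have hsum : ∑ i, S i = 0 :=
    le_antisymm (Finset.sum_nonpos fun i _ => hSi i) (key ▸ hI)
  have hS0 : ∀ i, S i = 0 := fun i =>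
    (Finset.sum_eq_zero_iff_of_nonpos fun i _ => hSi i).1 hsum i (Finset.mem_univ i)
  have hmem : ∀ i t x, x ∈ closedFace A i t → i.removeNth x ∈ Icc 0 (A ∘ i.succAbove) ∧
      (i.insertNth t (i.removeNth x) : Fin (n + 1) → ℝ) = x := by
    rintro i t x ⟨rfl, hx⟩
    refine ⟨⟨fun k => (hx _ (Fin.succAbove_ne i k)).1, fun k => (hx _ (Fin.succAbove_ne i k)).2⟩,
      by simp⟩
  refine ⟨eqOn_zero_of_integral_eq_zero hA hcont hdiv (key.trans hsum), fun i x hx => ?_,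
    fun i x hx => ?_⟩
  · have hz : ∫ x in Icc 0 (A ∘ i.succAbove), -F i (i.insertNth (A i) x) = 0 := by
      rw [integral_neg]
      have := hS0 i; simp only [hS] at this; linarith [hIf i, hIb i]
    obtain ⟨hy, hxy⟩ := hmem i _ x hx
    have := eqOn_zero_of_integral_eq_zero (fun k => hA _) (hface i _ (h1 i)).neg
      (fun x hx => neg_nonneg.2 (hfront i _ (insertNth_mem_closedFace hx))) hz _ hy
    simp only [Pi.neg_apply, hxy] at this; linarith
  · have hz : ∫ x in Icc 0 (A ∘ i.succAbove), F i (i.insertNth 0 x) = 0 := by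
      have := hS0 i; simp only [hS] at this; linarith [hIf i, hIb i]
    obtain ⟨hy, hxy⟩ := hmem i _ x hx
    have := eqOn_zero_of_integral_eq_zero (fun k => hA _) (hface i _ (h0 i))
      (fun x hx => hback i _ (insertNth_mem_closedFace hx)) hz _ hy
    rwa [hxy] at this

section Calculus

variable {n : ℕ} {f g : (Fin n → ℝ) → ℝ} {x : Fin n → ℝ} (i : Fin n)

lemma partialD_add (hf : DifferentiableAt ℝ f x) (hg : DifferentiableAt ℝ g x) :
    partialD i (fun y => f y + g y) x = partialD i f x + partialD i g x := by
  simp [partialD, fderiv_fun_add hf hg]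

lemma partialD_sub (hf : DifferentiableAt ℝ f x) (hg : DifferentiableAt ℝ g x) :
    partialD i (fun y => f y - g y) x = partialD i f x - partialD i g x := by
  simp [partialD, fderiv_fun_sub hf hg]

lemma partialD_mul (hf : DifferentiableAt ℝ f x) (hg : DifferentiableAt ℝ g x) :
    partialD i (fun y => f y * g y) x = partialD i f x * g x + f x * partialD i g x := by
  simp [partialD, fderiv_fun_mul hf hg]; ring

lemma partialD_sum {m : ℕ} {h : Fin m → (Fin n → ℝ) → ℝ}
    (hh : ∀ k, DifferentiableAt ℝ (h k) x) :
    partialD i (fun y => ∑ k, h k y) x = ∑ k, partialD i (h k) x := by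
  simp [partialD, fderiv_fun_sum (u := Finset.univ) fun k _ => hh k]

lemma partialD_const_mul (c : ℝ) (hf : DifferentiableAt ℝ f x) :
    partialD i (fun y => c * f y) x = c * partialD i f x := by
  simp [partialD, fderiv_const_mul hf]

lemma partialD_congr {V : Set (Fin n → ℝ)} (hV : IsOpen V) (hx : x ∈ V) (h : EqOn f g V) :
    partialD i f x = partialD i g x := by
  rw [partialD, partialD, (h.eventuallyEq_of_mem (hV.mem_nhds hx)).fderiv_eq]

lemma partialD_coord (k : Fin n) :
    partialD i (fun y : Fin n → ℝ => y k) x = if i = k then 1 else 0 := by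
  have : fderiv ℝ (fun y : Fin n → ℝ => y k) x = ContinuousLinearMap.proj k :=
    (ContinuousLinearMap.proj (R := ℝ) (φ := fun _ : Fin n => ℝ) k).fderiv
  simp [partialD, this, Pi.single_apply, eq_comm]

lemma partialD_exp_coord (τ : ℝ) (k : Fin n) :
    partialD i (fun y : Fin n → ℝ => Real.exp (τ * y k)) x =
      τ * (if i = k then 1 else 0) * Real.exp (τ * x k) := by
  have hd : DifferentiableAt ℝ (fun y : Fin n → ℝ => y k) x := by fun_prop
  have : partialD i (fun y : Fin n → ℝ => Real.exp (τ * y k)) x =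
      Real.exp (τ * x k) * partialD i (fun y : Fin n → ℝ => τ * y k) x := by
    simp [partialD, fderiv_exp (hd.const_mul τ)]
  rw [this, partialD_const_mul i τ hd, partialD_coord]
  ring

lemma partialD_comm (j : Fin n) (hf : ContDiffAt ℝ 2 f x) :
    partialD i (partialD j f) x = partialD j (partialD i f) x := by
  have hd : DifferentiableAt ℝ (fderiv ℝ f) x :=
    (hf.fderiv_right (m := 1) (by norm_num)).differentiableAt one_ne_zero
  have key : ∀ k l : Fin n, partialD k (partialD l f) x =
      fderiv ℝ (fderiv ℝ f) x (Pi.single k 1) (Pi.single l 1) := by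
    intro k l
    change fderiv ℝ (fun y => fderiv ℝ f y (Pi.single l 1)) x _ = _
    rw [fderiv_clm_apply hd (by fun_prop)]
    simp
  rw [key, key]
  exact hf.isSymmSndFDerivAt (by simp) _ _

end Calculus

/-- A solution of `|Δf| ≤ M |f|` on a box whose Cauchy data vanish on the two faces orthogonal to
`e₀`, and such that `f` and `∂₀f` vanish on the remaining faces, is zero. The proof is a Carleman
estimate with weight `exp (τ x₀)`. -/
theorem eq_zero_of_abs_laplacian_le {n : ℕ} {A : Fin (n + 1) → ℝ} (hA : ∀ i, 0 < A i)
    {V : Set (Fin (n + 1) → ℝ)} (hV : IsOpen V) (hAV : Icc 0 A ⊆ V)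
    {f : (Fin (n + 1) → ℝ) → ℝ} (hf : ContDiffOn ℝ 2 f V) {M : ℝ}
    (hM : ∀ x ∈ Icc 0 A, |∑ j, partialD j (partialD j f) x| ≤ M * |f x|)
    (hface : ∀ j, ∀ t, t = 0 ∨ t = A j → ∀ x ∈ closedFace A j t, f x = 0 ∧ partialD 0 f x = 0)
    (hface0 : ∀ t, t = 0 ∨ t = A 0 → ∀ x ∈ closedFace A 0 t, ∀ j, partialD j f x = 0) :
    ∀ x ∈ Icc 0 A, f x = 0 := by
  set τ : ℝ := (M + 2 * A 0) ^ 2 with hτ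
  set e : (Fin (n + 1) → ℝ) → ℝ := fun y => Real.exp (τ * y 0) with he
  set w : (Fin (n + 1) → ℝ) → ℝ := fun y => e y * f y with hw
  set δ : Fin (n + 1) → ℝ := fun i => if i = 0 then 1 else 0 with hδ
  have he2 : ContDiff ℝ 2 e := by
    simp only [he]; fun_prop
  have hw2 : ContDiffOn ℝ 2 w V := he2.contDiffOn.mul hf
  have dif1 : ∀ {g : (Fin (n + 1) → ℝ) → ℝ}, ContDiffOn ℝ 1 g V → ∀ x ∈ V,
      DifferentiableAt ℝ g x := fun hg x hx =>
    (hg.differentiableOn one_ne_zero).differentiableAt (hV.mem_nhds hx)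
  have hf1 : ContDiffOn ℝ 1 f V := hf.of_le (by norm_num)
  have hw1 : ContDiffOn ℝ 1 w V := hw2.of_le (by norm_num)
  have hDf : ∀ j, ContDiffOn ℝ 1 (partialD j f) V := partialD_contDiffOn hV hf
  have hDw : ∀ j, ContDiffOn ℝ 1 (partialD j w) V := partialD_contDiffOn hV hw2
  have hed : ∀ x, DifferentiableAt ℝ e x := fun x => (he2.differentiable two_ne_zero) x
  have he' : ∀ j x, partialD j e x = τ * δ j * e x := fun j x => partialD_exp_coord j τ 0
  have hDw_eq : ∀ j, EqOn (partialD j w) (fun x => e x * (partialD j f x + τ * δ j * f x)) V := by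
    intro j x hx
    simp only [hw]
    rw [partialD_mul j (hed x) (dif1 hf1 x hx), he']
    ring
  have hDDw : ∀ j, ∀ x ∈ V, partialD j (partialD j w) x =
      e x * partialD j (partialD j f) x + δ j * (2 * τ * partialD j w x - τ ^ 2 * w x) := by
    intro j x hx
    rw [partialD_congr j hV hx (hDw_eq j), partialD_mul j (hed x)
      ((dif1 (hDf j) x hx).fun_add ((dif1 hf1 x hx).const_mul _)),
      partialD_add j (dif1 (hDf j) x hx) ((dif1 hf1 x hx).const_mul _),
      partialD_const_mul j _ (dif1 hf1 x hx), he', hDw_eq j hx]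
    have : δ j * δ j = δ j := by simp [hδ]
    simp only [hw]
    linear_combination -(τ ^ 2 * e x * f x) * this
  set K : (Fin (n + 1) → ℝ) → ℝ := fun x =>
    (-(1 / 2)) * (∑ k, partialD k w x * partialD k w x) + (τ ^ 2 / 2 + x 0) * (w x * w x) with hK
  set F : Fin (n + 1) → (Fin (n + 1) → ℝ) → ℝ := fun j x =>
    partialD 0 w x * partialD j w x + δ j * K x with hF
  have hK1 : ContDiffOn ℝ 1 K V :=
    (contDiffOn_const.mul (ContDiffOn.sum fun k _ => (hDw k).mul (hDw k))).add
      ((by fun_prop : ContDiffOn ℝ 1 (fun x : Fin (n + 1) → ℝ => τ ^ 2 / 2 + x 0) V).mul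
        (hw1.mul hw1))
  have hF1 : ∀ j, ContDiffOn ℝ 1 (F j) V := fun j =>
    ((hDw 0).mul (hDw j)).add (contDiffOn_const.mul hK1)
  have hKd : ∀ x ∈ V, partialD 0 K x = -∑ k, partialD k w x * partialD k (partialD 0 w) x +
      w x * w x + (τ ^ 2 + 2 * x 0) * (w x * partialD 0 w x) := by
    intro x hx
    have hwx := dif1 hw1 x hx
    have hDwx := fun k => dif1 (hDw k) x hx
    have hc : DifferentiableAt ℝ (fun x : Fin (n + 1) → ℝ => x 0) x := by fun_prop
    have hc' : partialD 0 (fun x : Fin (n + 1) → ℝ => τ ^ 2 / 2 + x 0) x = 1 := by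
      rw [partialD_add 0 (by fun_prop) hc, partialD_coord]
      simp [partialD]
    have hs : DifferentiableAt ℝ (fun x => ∑ k, partialD k w x * partialD k w x) x :=
      DifferentiableAt.fun_sum fun k _ => (hDwx k).fun_mul (hDwx k)
    simp only [hK]
    rw [partialD_add 0 (hs.const_mul _) ((hc.const_add _).fun_mul (hwx.fun_mul hwx)),
      partialD_const_mul 0 _ hs, partialD_mul 0 (hc.const_add _) (hwx.fun_mul hwx),
      partialD_mul 0 hwx hwx, hc', partialD_sum 0 (fun k => (hDwx k).fun_mul (hDwx k))]
    have : ∀ k, partialD 0 (fun y => partialD k w y * partialD k w y) x =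
        2 * (partialD k w x * partialD k (partialD 0 w) x) := by
      intro k
      rw [partialD_mul 0 (hDwx k) (hDwx k),
        partialD_comm 0 k (hw2.contDiffAt (hV.mem_nhds hx))]
      ring
    simp only [this, ← Finset.mul_sum]
    ring
  have hdiv : ∀ x ∈ V, ∑ j, partialD j (F j) x =
      partialD 0 w x * (e x * ∑ j, partialD j (partialD j f) x) + 2 * τ * partialD 0 w x ^ 2 +
        w x ^ 2 + 2 * x 0 * w x * partialD 0 w x := by
    intro x hx
    have hDwx := fun k => dif1 (hDw k) x hx
    have h1 : ∀ j, partialD j (F j) x = partialD j w x * partialD j (partialD 0 w) x +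
        partialD 0 w x * (e x * partialD j (partialD j f) x) +
        δ j * (partialD 0 w x * (2 * τ * partialD j w x - τ ^ 2 * w x) + partialD j K x) := by
      intro j
      simp only [hF]
      rw [partialD_add j ((hDwx 0).fun_mul (hDwx j)) ((dif1 hK1 x hx).const_mul _),
        partialD_mul j (hDwx 0) (hDwx j), partialD_const_mul j _ (dif1 hK1 x hx), hDDw j x hx]
      ring
    have h2 : ∀ G : Fin (n + 1) → ℝ, ∑ j, δ j * G j = G 0 := fun G => by simp [hδ]
    simp only [h1, Finset.sum_add_distrib, h2, ← Finset.mul_sum, hKd x hx]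
    ring
  have hlow : ∀ x ∈ Icc 0 A, w x ^ 2 / 2 ≤ ∑ j, partialD j (F j) x := by
    intro x hx
    rw [hdiv x (hAV hx)]
    have he0 : 0 < e x := Real.exp_pos _
    have hx0 : |x 0| ≤ A 0 := by rw [abs_of_nonneg (hx.1 0)]; exact hx.2 0
    have h1 : |partialD 0 w x * (e x * ∑ j, partialD j (partialD j f) x)| ≤
        M * (|w x| * |partialD 0 w x|) := by
      rw [abs_mul, abs_mul, abs_of_pos he0]
      calc _ ≤ |partialD 0 w x| * (e x * (M * |f x|)) := by gcongr; exact hM x hx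
        _ = _ := by simp only [hw, abs_mul, abs_of_pos he0]; ring
    have h2 : |2 * x 0 * w x * partialD 0 w x| ≤ 2 * A 0 * (|w x| * |partialD 0 w x|) := by
      rw [show 2 * x 0 * w x * partialD 0 w x = 2 * (x 0 * (w x * partialD 0 w x)) by ring,
        abs_mul, abs_mul, abs_mul (w x), abs_two, mul_assoc]
      gcongr
    have h3 := neg_abs_le (partialD 0 w x * (e x * ∑ j, partialD j (partialD j f) x))
    have h4 := neg_abs_le (2 * x 0 * w x * partialD 0 w x)
    have h5 : 0 ≤ (|w x| - 2 * (M + 2 * A 0) * |partialD 0 w x|) ^ 2 := sq_nonneg _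
    rw [← sq_abs (w x), ← sq_abs (partialD 0 w x)]
    nlinarith [mul_nonneg (sq_nonneg (M + 2 * A 0)) (sq_nonneg |partialD 0 w x|),
      sq_nonneg (|w x| - (M + 2 * A 0) * |partialD 0 w x|)]
  have hFface : ∀ j, ∀ t, t = 0 ∨ t = A j → ∀ x ∈ closedFace A j t, F j x = 0 := by
    intro j t ht x hx
    have hxV : x ∈ V := hAV (closedFace_subset_Icc
      (by rcases ht with rfl | rfl <;> simp [(hA j).le]) hx)
    obtain ⟨hfx, hDfx⟩ := hface j t ht x hx
    have hD0 : partialD 0 w x = 0 := by rw [hDw_eq 0 hxV]; simp [hfx, hDfx]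
    by_cases hj : j = 0
    · subst hj
      have hDk : ∀ k, partialD k w x = 0 := fun k => by
        rw [hDw_eq k hxV]; simp [hfx, hface0 t ht x hx k]
      have hwx : w x = 0 := by simp [hw, hfx]
      simp [hF, hK, hDk, hwx]
    · simp [hF, hδ, hD0, hj]
  have hres := (divergence_rigidity hA hV hAV hF1
    (fun x hx => (by positivity : (0 : ℝ) ≤ w x ^ 2 / 2).trans (hlow x hx))
    (fun j x hx => (hFface j _ (Or.inr rfl) x hx).le)
    (fun j x hx => (hFface j _ (Or.inl rfl) x hx).ge)).1
  intro x hx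
  have h1 := hlow x hx
  rw [hres x hx] at h1
  have h2 : w x = 0 := by nlinarith [sq_nonneg (w x)]
  exact (mul_eq_zero.1 h2).resolve_left (Real.exp_pos _).ne'

lemma partialD_eq_zero_of_closedFace {n : ℕ} {A : Fin n → ℝ} (hA : ∀ i, 0 < A i)
    {V : Set (Fin n → ℝ)} (hV : IsOpen V) (hAV : Icc 0 A ⊆ V)
    {f : (Fin n → ℝ) → ℝ} (hf : ContDiffOn ℝ 1 f V) {i j : Fin n} (hij : i ≠ j) {t : ℝ}
    (ht : t ∈ Icc 0 (A j)) (h0 : ∀ x ∈ closedFace A j t, f x = 0) :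
    ∀ x ∈ closedFace A j t, partialD i f x = 0 := by
  refine eq_on_closedFace hA ht ((partialD_continuousOn hV hf i).mono hAV)
    (h := fun _ => 0) continuousOn_const fun x hx => ?_
  have hxV : x ∈ V := hAV (closedFace_subset_Icc ht (openFace_subset_closedFace hx))
  have hd := ((hf.differentiableOn one_ne_zero).differentiableAt (hV.mem_nhds hxV)).hasFDerivAt
  have hc : HasDerivAt (fun s => f (Function.update x i s)) (partialD i f x) (x i) := by
    refine HasFDerivAt.comp_hasDerivAt (x i) ?_ (hasDerivAt_update x i (x i))
    rwa [Function.update_eq_self]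
  have hz : (fun s => f (Function.update x i s)) =ᶠ[nhds (x i)] fun _ => 0 := by
    filter_upwards [Ioo_mem_nhds (hx.2 i hij).1 (hx.2 i hij).2] with s hs
    refine h0 _ (openFace_subset_closedFace ⟨by simp [hij.symm, hx.1], fun k hk => ?_⟩)
    by_cases hki : k = i
    · subst hki; simpa using hs
    · simpa [hki] using hx.2 k hk
  exact hc.unique ((hasDerivAt_const (x i) (0 : ℝ)).congr_of_eventuallyEq hz)

/-- Two real functions with `f Δg = g Δf` on a box, such that on each face either both vanish or
the impedance condition `∂_ν (f + i g) = i k (f + i g)` holds, vanish on the boundary. -/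
theorem eq_zero_on_faces_of_impedance_s9 {n : ℕ} {A : Fin (n + 1) → ℝ} (hA : ∀ i, 0 < A i)
    {V : Set (Fin (n + 1) → ℝ)} (hV : IsOpen V) (hAV : Icc 0 A ⊆ V)
    {f g : (Fin (n + 1) → ℝ) → ℝ} (hf : ContDiffOn ℝ 2 f V) (hg : ContDiffOn ℝ 2 g V)
    (hfg : ∀ x ∈ Icc 0 A, f x * ∑ j, partialD j (partialD j g) x =
      g x * ∑ j, partialD j (partialD j f) x) {k : ℝ} (hk : 0 < k)
    (hfront : ∀ j, ∀ x ∈ closedFace A j (A j), (f x = 0 ∧ g x = 0) ∨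
      (partialD j f x = -(k * g x) ∧ partialD j g x = k * f x))
    (hback : ∀ j, ∀ x ∈ closedFace A j 0, (f x = 0 ∧ g x = 0) ∨
      (partialD j f x = k * g x ∧ partialD j g x = -(k * f x))) :
    ∀ j, ∀ t, t = 0 ∨ t = A j → ∀ x ∈ closedFace A j t, f x = 0 ∧ g x = 0 := by
  have hDf : ∀ j, ContDiffOn ℝ 1 (partialD j f) V := partialD_contDiffOn hV hf
  have hDg : ∀ j, ContDiffOn ℝ 1 (partialD j g) V := partialD_contDiffOn hV hg
  have hf1 : ContDiffOn ℝ 1 f V := hf.of_le (by norm_num)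
  have hg1 : ContDiffOn ℝ 1 g V := hg.of_le (by norm_num)
  have dif1 : ∀ {h : (Fin (n + 1) → ℝ) → ℝ}, ContDiffOn ℝ 1 h V → ∀ x ∈ V,
      DifferentiableAt ℝ h x := fun hh x hx =>
    (hh.differentiableOn one_ne_zero).differentiableAt (hV.mem_nhds hx)
  set F : Fin (n + 1) → (Fin (n + 1) → ℝ) → ℝ := fun j x =>
    g x * partialD j f x - f x * partialD j g x with hF
  have hF1 : ∀ j, ContDiffOn ℝ 1 (F j) V := fun j =>
    (hg1.mul (hDf j)).sub (hf1.mul (hDg j))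
  have hdiv : ∀ x ∈ Icc 0 A, ∑ j, partialD j (F j) x = 0 := by
    intro x hx
    have hxV := hAV hx
    have h1 : ∀ j, partialD j (F j) x =
        g x * partialD j (partialD j f) x - f x * partialD j (partialD j g) x := by
      intro j
      simp only [hF]
      rw [partialD_sub j ((dif1 hg1 x hxV).fun_mul (dif1 (hDf j) x hxV))
        ((dif1 hf1 x hxV).fun_mul (dif1 (hDg j) x hxV)),
        partialD_mul j (dif1 hg1 x hxV) (dif1 (hDf j) x hxV),
        partialD_mul j (dif1 hf1 x hxV) (dif1 (hDg j) x hxV)]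
      ring
    simp only [h1, Finset.sum_sub_distrib, ← Finset.mul_sum, hfg x hx, sub_self]
  have hFf : ∀ j, ∀ x ∈ closedFace A j (A j), (f x = 0 ∧ g x = 0) ∨
      F j x = -(k * (f x ^ 2 + g x ^ 2)) := by
    intro j x hx
    refine (hfront j x hx).imp_right fun h => ?_
    simp only [hF, h.1, h.2]; ring
  have hFb : ∀ j, ∀ x ∈ closedFace A j 0, (f x = 0 ∧ g x = 0) ∨
      F j x = k * (f x ^ 2 + g x ^ 2) := by
    intro j x hx
    refine (hback j x hx).imp_right fun h => ?_
    simp only [hF, h.1, h.2]; ring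
  obtain ⟨-, h1, h2⟩ := divergence_rigidity hA hV hAV hF1 (fun x hx => (hdiv x hx).ge)
    (fun j x hx => by
      rcases hFf j x hx with h | h
      · simp [hF, h.1, h.2]
      · rw [h]; have : 0 ≤ k * (f x ^ 2 + g x ^ 2) := by positivity
        linarith)
    (fun j x hx => by
      rcases hFb j x hx with h | h
      · simp [hF, h.1, h.2]
      · rw [h]; positivity)
  have hsq : ∀ x, k * (f x ^ 2 + g x ^ 2) = 0 → f x = 0 ∧ g x = 0 := by
    intro x hx
    have := (mul_eq_zero.1 hx).resolve_left hk.ne'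
    constructor <;> nlinarith [sq_nonneg (f x), sq_nonneg (g x)]
  rintro j t (rfl | rfl) x hx
  · rcases hFb j x hx with h | h
    · exact h
    · exact hsq x (h ▸ h2 j x hx)
  · rcases hFf j x hx with h | h
    · exact h
    · exact hsq x (by linarith [h1 j x hx])

/-- The curried partial derivatives, indexed by the coordinate. -/
noncomputable def curriedPD (i : Fin 3) (h : ℝ → ℝ → ℝ → ℂ) : ℝ → ℝ → ℝ → ℂ :=
  match i with
  | 0 => pd1 h
  | 1 => pd2 h
  | 2 => pd3 h

/-- A curried function of three variables, as a function on `Fin 3 → ℝ`. -/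
def uncurryFin (h : ℝ → ℝ → ℝ → ℂ) (p : Fin 3 → ℝ) : ℂ := h (p 0) (p 1) (p 2)

lemma uncurryFin_curriedPD {h : ℝ → ℝ → ℝ → ℂ} {p : Fin 3 → ℝ}
    (hd : DifferentiableAt ℝ (uncurryFin h) p) (i : Fin 3) :
    uncurryFin (curriedPD i h) p = fderiv ℝ (uncurryFin h) p (Pi.single i 1) := by
  have hc : HasDerivAt (fun s => uncurryFin h (Function.update p i s))
      (fderiv ℝ (uncurryFin h) p (Pi.single i 1)) (p i) := by
    have hd' := hd.hasFDerivAt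
    rw [← Function.update_eq_self i p] at hd'
    have hcomp := hd'.comp_hasDerivAt (p i) (hasDerivAt_update p i (p i))
    rw [Function.update_eq_self] at hcomp
    exact hcomp
  rw [← hc.deriv]
  fin_cases i <;> simp [uncurryFin, curriedPD, pd1, pd2, pd3]

lemma re_fderiv {n : ℕ} {h : (Fin n → ℝ) → ℂ} {p : Fin n → ℝ} (hd : DifferentiableAt ℝ h p)
    (i : Fin n) : (fderiv ℝ h p (Pi.single i 1)).re = partialD i (fun y => (h y).re) p := by
  have := (Complex.reCLM.hasFDerivAt.comp p hd.hasFDerivAt).fderiv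
  rw [partialD, show (fun y => (h y).re) = Complex.reCLM ∘ h from rfl, this]
  rfl

lemma im_fderiv {n : ℕ} {h : (Fin n → ℝ) → ℂ} {p : Fin n → ℝ} (hd : DifferentiableAt ℝ h p)
    (i : Fin n) : (fderiv ℝ h p (Pi.single i 1)).im = partialD i (fun y => (h y).im) p := by
  have := (Complex.imCLM.hasFDerivAt.comp p hd.hasFDerivAt).fderiv
  rw [partialD, show (fun y => (h y).im) = Complex.imCLM ∘ h from rfl, this]
  rfl

lemma curriedPD_re_im {h : ℝ → ℝ → ℝ → ℂ} {p : Fin 3 → ℝ}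
    (hd : DifferentiableAt ℝ (uncurryFin h) p) (i : Fin 3) :
    (uncurryFin (curriedPD i h) p).re = partialD i (fun y => (uncurryFin h y).re) p ∧
    (uncurryFin (curriedPD i h) p).im = partialD i (fun y => (uncurryFin h y).im) p := by
  rw [uncurryFin_curriedPD hd, re_fderiv hd, im_fderiv hd]
  exact ⟨rfl, rfl⟩

lemma curriedPD_curriedPD_re_im {h : ℝ → ℝ → ℝ → ℂ} {V : Set (Fin 3 → ℝ)} (hV : IsOpen V)
    (hh : ContDiffOn ℝ 2 (uncurryFin h) V) {p : Fin 3 → ℝ} (hp : p ∈ V) (i : Fin 3) :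
    (uncurryFin (curriedPD i (curriedPD i h)) p).re =
      partialD i (partialD i (fun y => (uncurryFin h y).re)) p ∧
    (uncurryFin (curriedPD i (curriedPD i h)) p).im =
      partialD i (partialD i (fun y => (uncurryFin h y).im)) p := by
  have hd : ∀ x ∈ V, DifferentiableAt ℝ (uncurryFin h) x := fun x hx =>
    (hh.differentiableOn two_ne_zero).differentiableAt (hV.mem_nhds hx)
  have h1 : ContDiffOn ℝ 1 (fun x => fderiv ℝ (uncurryFin h) x (Pi.single i 1)) V :=
    (hh.fderiv_of_isOpen hV (by norm_num)).clm_apply contDiffOn_const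
  have h2 : DifferentiableAt ℝ (uncurryFin (curriedPD i h)) p :=
    ((h1.differentiableOn one_ne_zero).congr fun x hx =>
      uncurryFin_curriedPD (hd x hx) i).differentiableAt (hV.mem_nhds hp)
  rw [(curriedPD_re_im h2 i).1, (curriedPD_re_im h2 i).2]
  exact ⟨partialD_congr i hV hp fun x hx => (curriedPD_re_im (hd x hx) i).1,
    partialD_congr i hV hp fun x hx => (curriedPD_re_im (hd x hx) i).2⟩

/-- Uniqueness for the mixed Dirichlet–impedance boundary value problem on the box
`Υ = (0,a) × (0,b) × (0,c)`: a solution of `Δu + q u = 0` (with `q` real valued and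
continuous) vanishing on the top face `Γ₁ = {x₃ = 0}` and satisfying the impedance
condition `∂_ν u = i k₀ u` on the relative interior of each remaining face vanishes
identically on `Υ`. -/
theorem uniqueness_mixed_problem
    (a b c k₀ : ℝ) (ha : 0 < a) (hb : 0 < b) (hc : 0 < c) (hk₀ : 0 < k₀)
    (q : ℝ × ℝ × ℝ → ℝ)
    (hq : ContinuousOn q (Icc 0 a ×ˢ Icc 0 b ×ˢ Icc 0 c))
    (u : ℝ → ℝ → ℝ → ℂ)
    (U : Set (ℝ × ℝ × ℝ)) (hU : IsOpen U)
    (hQU : Icc 0 a ×ˢ Icc 0 b ×ˢ Icc 0 c ⊆ U)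
    (hu : ContDiffOn ℝ 2 (fun p : ℝ × ℝ × ℝ => u p.1 p.2.1 p.2.2) U)
    (hpde : ∀ p ∈ Ioo 0 a ×ˢ Ioo 0 b ×ˢ Ioo 0 c,
      lap u p.1 p.2.1 p.2.2 + (q p : ℂ) * u p.1 p.2.1 p.2.2 = 0)
    (hdir : ∀ x ∈ Icc 0 a, ∀ y ∈ Icc 0 b, u x y 0 = 0)
    (himp1m : ∀ y ∈ Ioo 0 b, ∀ z ∈ Ioo 0 c,
      -pd1 u 0 y z = Complex.I * (k₀ : ℂ) * u 0 y z)
    (himp1p : ∀ y ∈ Ioo 0 b, ∀ z ∈ Ioo 0 c,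
      pd1 u a y z = Complex.I * (k₀ : ℂ) * u a y z)
    (himp2m : ∀ x ∈ Ioo 0 a, ∀ z ∈ Ioo 0 c,
      -pd2 u x 0 z = Complex.I * (k₀ : ℂ) * u x 0 z)
    (himp2p : ∀ x ∈ Ioo 0 a, ∀ z ∈ Ioo 0 c,
      pd2 u x b z = Complex.I * (k₀ : ℂ) * u x b z)
    (himp3p : ∀ x ∈ Ioo 0 a, ∀ y ∈ Ioo 0 b,
      pd3 u x y c = Complex.I * (k₀ : ℂ) * u x y c) :
    ∀ p ∈ Ioo 0 a ×ˢ Ioo 0 b ×ˢ Ioo 0 c, u p.1 p.2.1 p.2.2 = 0 := by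
  set A : Fin 3 → ℝ := ![a, b, c] with hAdef
  have hA : ∀ i, 0 < A i := by intro i; fin_cases i <;> simp [hAdef, ha, hb, hc]
  set Φ : (Fin 3 → ℝ) → ℝ × ℝ × ℝ := fun p => (p 0, p 1, p 2) with hΦ
  have hΦc : ContDiff ℝ 2 Φ := by simp only [hΦ]; fun_prop
  set V : Set (Fin 3 → ℝ) := Φ ⁻¹' U with hVdef
  have hV : IsOpen V := hU.preimage hΦc.continuous
  have hΦI : MapsTo Φ (Icc 0 A) (Icc 0 a ×ˢ Icc 0 b ×ˢ Icc 0 c) := fun p hp =>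
    ⟨⟨hp.1 0, hp.2 0⟩, ⟨hp.1 1, hp.2 1⟩, ⟨hp.1 2, hp.2 2⟩⟩
  have hAV : Icc 0 A ⊆ V := fun p hp => hQU (hΦI hp)
  have hh : ContDiffOn ℝ 2 (uncurryFin u) V := hu.comp hΦc.contDiffOn fun _ hp => hp
  set f : (Fin 3 → ℝ) → ℝ := fun p => (uncurryFin u p).re with hfdef
  set g : (Fin 3 → ℝ) → ℝ := fun p => (uncurryFin u p).im with hgdef
  have hf : ContDiffOn ℝ 2 f V := Complex.reCLM.contDiff.comp_contDiffOn hh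
  have hg : ContDiffOn ℝ 2 g V := Complex.imCLM.contDiff.comp_contDiffOn hh
  have hf1 : ContDiffOn ℝ 1 f V := hf.of_le (by norm_num)
  have hg1 : ContDiffOn ℝ 1 g V := hg.of_le (by norm_num)
  have hd : ∀ p ∈ Icc 0 A, DifferentiableAt ℝ (uncurryFin u) p := fun p hp =>
    (hh.differentiableOn two_ne_zero).differentiableAt (hV.mem_nhds (hAV hp))
  have hcΔ : ∀ {w : (Fin 3 → ℝ) → ℝ}, ContDiffOn ℝ 2 w V →
      ContinuousOn (fun p => ∑ j, partialD j (partialD j w) p + q (Φ p) * w p) (Icc 0 A) := by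
    intro w hw
    refine (continuousOn_finsetSum _ fun j _ =>
      (partialD_continuousOn hV (partialD_contDiffOn hV hw j) j).mono hAV).add ?_
    exact (hq.comp hΦc.continuous.continuousOn hΦI).mul (hw.continuousOn.mono hAV)
  have hsub : (pi univ fun i => Ioo 0 (A i)) ⊆ Icc 0 A := by
    rw [← interior_Icc_pi]; exact interior_subset
  have hpde' : ∀ p ∈ pi univ fun i => Ioo 0 (A i),
      ∑ j, partialD j (partialD j f) p + q (Φ p) * f p = 0 ∧
      ∑ j, partialD j (partialD j g) p + q (Φ p) * g p = 0 := by
    intro p hp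
    have h := hpde (Φ p) ⟨hp 0 trivial, hp 1 trivial, hp 2 trivial⟩
    have hD := curriedPD_curriedPD_re_im hV hh (hAV (hsub hp))
    have hre := congrArg Complex.re h
    have him := congrArg Complex.im h
    rw [Fin.sum_univ_three, Fin.sum_univ_three, ← (hD 0).1, ← (hD 1).1, ← (hD 2).1,
      ← (hD 0).2, ← (hD 1).2, ← (hD 2).2]
    simp only [lap, Complex.add_re, Complex.add_im, Complex.re_ofReal_mul,
      Complex.im_ofReal_mul, Complex.zero_re, Complex.zero_im] at hre him
    exact ⟨hre, him⟩
  have hpf : ∀ p ∈ Icc 0 A, ∑ j, partialD j (partialD j f) p + q (Φ p) * f p = 0 :=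
    EqOn.of_subset_closure (g := fun _ => 0) (fun p hp => (hpde' p hp).1) (hcΔ hf)
      continuousOn_const hsub (Icc_subset_closure_interior_pi hA)
  have hpg : ∀ p ∈ Icc 0 A, ∑ j, partialD j (partialD j g) p + q (Φ p) * g p = 0 :=
    EqOn.of_subset_closure (g := fun _ => 0) (fun p hp => (hpde' p hp).2) (hcΔ hg)
      continuousOn_const hsub (Icc_subset_closure_interior_pi hA)
  have h0 : ∀ j, (0 : ℝ) ∈ Icc 0 (A j) := fun j => ⟨le_rfl, (hA j).le⟩
  have h1 : ∀ j, A j ∈ Icc 0 (A j) := fun j => ⟨(hA j).le, le_rfl⟩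
  have hbot : ∀ p ∈ closedFace A 2 0, f p = 0 ∧ g p = 0 := by
    intro p hp
    have : uncurryFin u p = 0 := by
      rw [uncurryFin, hp.1]
      exact hdir _ (hp.2 0 (by decide)) _ (hp.2 1 (by decide))
    simp [hfdef, hgdef, this]
  have hext : ∀ (κ : ℝ) (j : Fin 3), ∀ t ∈ Icc 0 (A j),
      (∀ p ∈ openFace A j t,
        uncurryFin (curriedPD j u) p = Complex.I * (κ : ℂ) * uncurryFin u p) →
      ∀ p ∈ closedFace A j t, partialD j f p = -(κ * g p) ∧ partialD j g p = κ * f p := by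
    intro κ j t ht h
    have h' : ∀ p ∈ openFace A j t, partialD j f p = -(κ * g p) ∧ partialD j g p = κ * f p := by
      intro p hp
      have hD := curriedPD_re_im
        (hd p (closedFace_subset_Icc ht (openFace_subset_closedFace hp))) j
      rw [h p hp] at hD
      rw [hfdef, hgdef, ← hD.1, ← hD.2]
      simp
    have hcf := hf.continuousOn.mono hAV
    have hcg := hg.continuousOn.mono hAV
    exact fun p hp => ⟨eq_on_closedFace hA ht ((partialD_continuousOn hV hf1 j).mono hAV)
      (h := fun p => -(κ * g p)) (by fun_prop) (fun p hp => (h' p hp).1) hp,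
      eq_on_closedFace hA ht ((partialD_continuousOn hV hg1 j).mono hAV)
      (h := fun p => κ * f p) (by fun_prop) (fun p hp => (h' p hp).2) hp⟩
  have hfront : ∀ j, ∀ p ∈ closedFace A j (A j),
      partialD j f p = -(k₀ * g p) ∧ partialD j g p = k₀ * f p := by
    intro j
    refine hext k₀ j _ (h1 j) fun p hp => ?_
    obtain ⟨hpt, hp⟩ := hp
    fin_cases j
    · replace hpt : p 0 = a := hpt
      change pd1 u (p 0) (p 1) (p 2) = _ * u (p 0) (p 1) (p 2)
      rw [hpt]
      exact himp1p _ (hp 1 (by decide)) _ (hp 2 (by decide))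
    · replace hpt : p 1 = b := hpt
      change pd2 u (p 0) (p 1) (p 2) = _ * u (p 0) (p 1) (p 2)
      rw [hpt]
      exact himp2p _ (hp 0 (by decide)) _ (hp 2 (by decide))
    · replace hpt : p 2 = c := hpt
      change pd3 u (p 0) (p 1) (p 2) = _ * u (p 0) (p 1) (p 2)
      rw [hpt]
      exact himp3p _ (hp 0 (by decide)) _ (hp 1 (by decide))
  have hback : ∀ j, j ≠ 2 → ∀ p ∈ closedFace A j 0,
      partialD j f p = k₀ * g p ∧ partialD j g p = -(k₀ * f p) := by
    intro j hj p hp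
    have := hext (-k₀) j _ (h0 j) (fun p hp => ?_) p hp
    · simpa using this
    obtain ⟨hpt, hp⟩ := hp
    push_cast
    rw [mul_neg, neg_mul, eq_neg_iff_add_eq_zero, ← neg_eq_iff_add_eq_zero]
    fin_cases j
    · replace hpt : p 0 = 0 := hpt
      change -pd1 u (p 0) (p 1) (p 2) = _ * u (p 0) (p 1) (p 2)
      rw [hpt]
      exact himp1m _ (hp 1 (by decide)) _ (hp 2 (by decide))
    · replace hpt : p 1 = 0 := hpt
      change -pd2 u (p 0) (p 1) (p 2) = _ * u (p 0) (p 1) (p 2)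
      rw [hpt]
      exact himp2m _ (hp 0 (by decide)) _ (hp 2 (by decide))
    · exact absurd rfl hj
  have hzero := eq_zero_on_faces_of_impedance_s9 hA hV hAV hf hg
    (fun p hp => by linear_combination f p * hpg p hp - g p * hpf p hp) hk₀
    (fun j p hp => Or.inr (hfront j p hp))
    (fun j p hp => by
      by_cases hj : j = 2
      · subst hj; exact Or.inl (hbot p hp)
      · exact Or.inr (hback j hj p hp))
  have ht01 : ∀ j t, t = 0 ∨ t = A j → t ∈ Icc 0 (A j) := by
    rintro j t (rfl | rfl)
    exacts [h0 j, h1 j]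
  have hn0 : ∀ t, t = 0 ∨ t = A 0 → ∀ p ∈ closedFace A 0 t, ∀ j,
      partialD j f p = 0 ∧ partialD j g p = 0 := by
    intro t ht p hp j
    by_cases hj : j = 0
    · subst hj
      have hz := hzero 0 t ht p hp
      rcases ht with rfl | rfl
      · simpa [hz.1, hz.2] using hback 0 (by decide) p hp
      · simpa [hz.1, hz.2] using hfront 0 p hp
    · exact ⟨partialD_eq_zero_of_closedFace hA hV hAV hf1 hj (ht01 0 t ht)
          (fun p hp => (hzero 0 t ht p hp).1) p hp,
        partialD_eq_zero_of_closedFace hA hV hAV hg1 hj (ht01 0 t ht)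
          (fun p hp => (hzero 0 t ht p hp).2) p hp⟩
  have hD0 : ∀ j t, t = 0 ∨ t = A j → ∀ p ∈ closedFace A j t,
      partialD 0 f p = 0 ∧ partialD 0 g p = 0 := by
    intro j t ht p hp
    by_cases hj : j = 0
    · subst hj; exact hn0 t ht p hp 0
    · exact ⟨partialD_eq_zero_of_closedFace hA hV hAV hf1 (Ne.symm hj) (ht01 j t ht)
          (fun p hp => (hzero j t ht p hp).1) p hp,
        partialD_eq_zero_of_closedFace hA hV hAV hg1 (Ne.symm hj) (ht01 j t ht)
          (fun p hp => (hzero j t ht p hp).2) p hp⟩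
  obtain ⟨M, hM⟩ :=
    (isCompact_Icc.prod (isCompact_Icc.prod isCompact_Icc)).exists_bound_of_continuousOn hq
  have hbound : ∀ p ∈ Icc 0 A, ∀ s w : ℝ, s + q (Φ p) * w = 0 → |s| ≤ M * |w| := by
    intro p hp s w h
    rw [eq_neg_of_add_eq_zero_left h, abs_neg, abs_mul]
    gcongr
    exact hM _ (hΦI hp)
  have hfz := eq_zero_of_abs_laplacian_le hA hV hAV hf (fun p hp => hbound p hp _ _ (hpf p hp))
    (fun j t ht p hp => ⟨(hzero j t ht p hp).1, (hD0 j t ht p hp).1⟩)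
    (fun t ht p hp j => (hn0 t ht p hp j).1)
  have hgz := eq_zero_of_abs_laplacian_le hA hV hAV hg (fun p hp => hbound p hp _ _ (hpg p hp))
    (fun j t ht p hp => ⟨(hzero j t ht p hp).2, (hD0 j t ht p hp).2⟩)
    (fun t ht p hp j => (hn0 t ht p hp j).2)
  rintro ⟨x, y, z⟩ ⟨hx, hy, hz⟩
  have hp : (![x, y, z] : Fin 3 → ℝ) ∈ Icc 0 A := by
    apply hsub
    intro i _
    fin_cases i
    exacts [hx, hy, hz]
  exact Complex.ext (hfz _ hp) (hgz _ hp)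
end
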